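/- arXiv:2504.01267 — 5 statements merged into one kernel-verified Lean document; each statement's English description precedes it below -/
import Mathlib

section
/- Let X be a real Banach space with dim X ≥ 2 and let p ∈ [0,1]. Then MR_p(X) = sup{ ‖λx − λ^{1−p}y‖ / ‖λ^{2−p}x − y‖ : x, y ∈ S_X, λ > 0, λ ≠ 1 }, where S_X denotes the unit sphere of X. -/
open Filter

/-- The `p`-angular distance `α_p[x,y] = ‖ ‖x‖^(p-1) • x − ‖y‖^(p-1) • y ‖`. -/
noncomputable def alphaP {X : Type*} [NormedAddCommGroup X] [NormedSpace ℝ X]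
    (p : ℝ) (x y : X) : ℝ :=
  ‖(‖x‖ ^ (p - 1)) • x - (‖y‖ ^ (p - 1)) • y‖

/-- The skew `p`-angular distance `β_p[x,y] = ‖ ‖y‖^(p-1) • x − ‖x‖^(p-1) • y ‖`. -/
noncomputable def betaP {X : Type*} [NormedAddCommGroup X] [NormedSpace ℝ X]
    (p : ℝ) (x y : X) : ℝ :=
  ‖(‖y‖ ^ (p - 1)) • x - (‖x‖ ^ (p - 1)) • y‖

/-- The Maligranda–Rooin constant `MR_p(X)`. -/
noncomputable def MRconst (X : Type*) [NormedAddCommGroup X] [NormedSpace ℝ X]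
    (p : ℝ) : ℝ :=
  sSup { r : ℝ | ∃ x y : X, x ≠ 0 ∧ y ≠ 0 ∧ betaP p x y ≠ 0 ∧
    r = alphaP p x y / betaP p x y }

section Ratio

variable {X : Type*} [NormedAddCommGroup X] [NormedSpace ℝ X]

/-- In polar coordinates, the normalised pair `(‖x‖ / ‖y‖) • u`, `v` computes both the
`p`-angular distance and its skew version up to a common positive factor. -/
lemma exists_pos_mul_alphaP_betaP (p : ℝ) {u v : X} (hu : ‖u‖ = 1) (hv : ‖v‖ = 1)
    {a b : ℝ} (ha : 0 < a) (hb : 0 < b) :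
    ∃ c : ℝ, 0 < c ∧
      ‖(a / b) • u - ((a / b) ^ (1 - p)) • v‖ = c * alphaP p (a • u) (b • v) ∧
      ‖((a / b) ^ (2 - p)) • u - v‖ = c * betaP p (a • u) (b • v) := by
  have hna : ‖a • u‖ = a := by rw [norm_smul, hu, mul_one, Real.norm_of_nonneg ha.le]
  have hnb : ‖b • v‖ = b := by rw [norm_smul, hv, mul_one, Real.norm_of_nonneg hb.le]
  have hA := Real.rpow_pos_of_pos ha (p - 1)
  have hB := Real.rpow_pos_of_pos hb (p - 1)
  have h₁ : (a / b) ^ (1 - p) = b ^ (p - 1) / a ^ (p - 1) := by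
    rw [show 1 - p = -(p - 1) by ring, Real.rpow_neg (div_pos ha hb).le,
      Real.div_rpow ha.le hb.le, inv_div]
  have h₂ : (a / b) ^ (2 - p) = a / b * (b ^ (p - 1) / a ^ (p - 1)) := by
    rw [← h₁, show 2 - p = 1 + (1 - p) by ring, Real.rpow_add (div_pos ha hb), Real.rpow_one]
  rw [h₁, h₂, alphaP, betaP, hna, hnb]
  generalize a ^ (p - 1) = A at *
  generalize b ^ (p - 1) = B at *
  have hc : 0 < 1 / (A * b) := by positivity
  refine ⟨1 / (A * b), hc, ?_, ?_⟩
  · rw [← Real.norm_of_nonneg hc.le, ← norm_smul]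
    congr 1
    match_scalars <;> field_simp
  · rw [← Real.norm_of_nonneg hc.le, ← norm_smul]
    congr 1
    match_scalars <;> field_simp

/-- The ratio of the two angular distances in polar coordinates. -/
lemma alphaP_div_betaP_smul (p : ℝ) {u v : X} (hu : ‖u‖ = 1) (hv : ‖v‖ = 1)
    {a b : ℝ} (ha : 0 < a) (hb : 0 < b) :
    alphaP p (a • u) (b • v) / betaP p (a • u) (b • v) =
      ‖(a / b) • u - ((a / b) ^ (1 - p)) • v‖ / ‖((a / b) ^ (2 - p)) • u - v‖ := by
  obtain ⟨c, hc, h₁, h₂⟩ := exists_pos_mul_alphaP_betaP p hu hv ha hb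
  rw [h₁, h₂, mul_div_mul_left _ _ hc.ne']

/-- Vectors of different norms are different. -/
lemma rpow_smul_sub_ne_zero {u v : X} (hu : ‖u‖ = 1) (hv : ‖v‖ = 1) {l q : ℝ} (hl : 0 < l)
    (hl1 : l ≠ 1) (hq : q ≠ 0) : ‖(l ^ q) • u - v‖ ≠ 0 := by
  intro h
  have h := congrArg norm (sub_eq_zero.mp (norm_eq_zero.mp h))
  rw [norm_smul, hu, hv, mul_one, Real.norm_of_nonneg (Real.rpow_nonneg hl.le q),
    ← Real.one_rpow q, Real.rpow_left_inj hl.le zero_le_one hq] at h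
  exact hl1 h

variable (X) in
/-- The ratios in polar coordinates with distinct radii. -/
def unitRatios (p : ℝ) : Set ℝ :=
  { r : ℝ | ∃ x y : X, ‖x‖ = 1 ∧ ‖y‖ = 1 ∧ ∃ l : ℝ, 0 < l ∧ l ≠ 1 ∧
      r = ‖l • x - (l ^ (1 - p)) • y‖ / ‖(l ^ (2 - p)) • x - y‖ }

/-- Pairs of equal norm contribute only the ratio `1`, all others a ratio of `unitRatios`. -/
lemma setOf_alphaP_div_betaP [Nontrivial X] {p : ℝ} (hp : p ≠ 2) :
    { r : ℝ | ∃ x y : X, x ≠ 0 ∧ y ≠ 0 ∧ betaP p x y ≠ 0 ∧ r = alphaP p x y / betaP p x y } =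
      insert 1 (unitRatios X p) := by
  ext r
  constructor
  · rintro ⟨x, y, hx, hy, hβ, rfl⟩
    by_cases hxy : ‖x‖ = ‖y‖
    · left
      rw [betaP, hxy] at hβ
      rw [alphaP, betaP, hxy, div_self hβ]
    · right
      have hx' := norm_pos_iff.mpr hx
      have hy' := norm_pos_iff.mpr hy
      have hu : ‖‖x‖⁻¹ • x‖ = 1 := norm_smul_inv_norm (𝕜 := ℝ) hx
      have hv : ‖‖y‖⁻¹ • y‖ = 1 := norm_smul_inv_norm (𝕜 := ℝ) hy
      refine ⟨_, _, hu, hv, ‖x‖ / ‖y‖, div_pos hx' hy', ?_, ?_⟩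
      · rwa [Ne, div_eq_one_iff_eq hy'.ne']
      · rw [← alphaP_div_betaP_smul p hu hv hx' hy', smul_inv_smul₀ hx'.ne',
          smul_inv_smul₀ hy'.ne']
  · rintro (rfl | ⟨u, v, hu, hv, l, hl, hl1, rfl⟩)
    · obtain ⟨u, hu⟩ := exists_norm_eq X zero_le_one
      have hu0 : u ≠ 0 := norm_ne_zero_iff.mp (by simp [hu])
      have hβ : betaP p u (-u) ≠ 0 := by
        simp [betaP, hu, ← two_smul ℝ u, norm_smul]
      refine ⟨u, -u, hu0, neg_ne_zero.mpr hu0, hβ, ?_⟩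
      rw [eq_div_iff hβ, one_mul, alphaP, betaP, norm_neg]
    · have h := alphaP_div_betaP_smul p hu hv hl one_pos
      obtain ⟨c, hc, -, h₂⟩ := exists_pos_mul_alphaP_betaP p hu hv hl one_pos
      have hne := rpow_smul_sub_ne_zero hu hv hl hl1 (sub_ne_zero.mpr hp.symm)
      rw [div_one] at h h₂
      rw [h₂] at hne
      have hβ := right_ne_zero_of_mul hne
      refine ⟨l • u, (1 : ℝ) • v, ?_, ?_, hβ, h.symm⟩
      · exact smul_ne_zero hl.ne' (norm_ne_zero_iff.mp (by simp [hu]))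
      · exact smul_ne_zero one_ne_zero (norm_ne_zero_iff.mp (by simp [hv]))

/-- Antipodal unit vectors give ratios approaching `1`. -/
lemma one_le_sSup_unitRatios [Nontrivial X] {p : ℝ} (h : BddAbove (unitRatios X p)) :
    1 ≤ sSup (unitRatios X p) := by
  obtain ⟨u, hu⟩ := exists_norm_eq X zero_le_one
  have hne : ‖((1 : ℝ) ^ (2 - p)) • u - (-u)‖ ≠ 0 := by
    simp [hu, ← two_smul ℝ u, norm_smul]
  have hcont : ContinuousAt (fun l : ℝ =>
      ‖l • u - (l ^ (1 - p)) • (-u)‖ / ‖(l ^ (2 - p)) • u - (-u)‖) 1 := by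
    have hr (q : ℝ) : ContinuousAt (fun l : ℝ => l ^ q) 1 :=
      Real.continuousAt_rpow_const _ _ (Or.inl one_ne_zero)
    exact ((continuousAt_id.smul continuousAt_const).sub
      ((hr _).smul continuousAt_const)).norm.div
      (((hr _).smul continuousAt_const).sub continuousAt_const).norm hne
  have hlim := hcont.tendsto.mono_left (nhdsWithin_le_nhds (s := {1}ᶜ))
  rw [show ‖(1 : ℝ) • u - ((1 : ℝ) ^ (1 - p)) • (-u)‖ / ‖((1 : ℝ) ^ (2 - p)) • u - (-u)‖ = 1 by
    rw [Real.one_rpow] at hne ⊢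
    rw [Real.one_rpow, one_smul, one_smul] at *
    exact div_self hne] at hlim
  refine le_of_tendsto hlim ?_
  filter_upwards [self_mem_nhdsWithin, nhdsWithin_le_nhds (Ioi_mem_nhds one_pos)] with l hl1 hl
  exact le_csSup h ⟨u, -u, hu, by rw [norm_neg, hu], l, hl, hl1, rfl⟩

end Ratio

theorem stmt0 (X : Type*) [NormedAddCommGroup X] [NormedSpace ℝ X] [CompleteSpace X]
    (hdim : 2 ≤ Module.rank ℝ X) (p : ℝ) (hp0 : 0 ≤ p) (hp1 : p ≤ 1) :
    MRconst X p = sSup { r : ℝ | ∃ x y : X, ‖x‖ = 1 ∧ ‖y‖ = 1 ∧ ∃ l : ℝ, 0 < l ∧ l ≠ 1 ∧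
      r = ‖l • x - (l ^ (1 - p)) • y‖ / ‖(l ^ (2 - p)) • x - y‖ } := by
  have : Nontrivial X := rank_pos_iff_nontrivial.mp (two_pos.trans_le hdim)
  change MRconst X p = sSup (unitRatios X p)
  rw [MRconst, setOf_alphaP_div_betaP (by linarith : p < 2).ne]
  by_cases h : BddAbove (unitRatios X p)
  · obtain ⟨u, hu⟩ := exists_norm_eq X zero_le_one
    rw [csSup_insert h ⟨_, u, u, hu, hu, 2, two_pos, by norm_num, rfl⟩]
    exact sup_eq_right.mpr (one_le_sSup_unitRatios h)
  · rw [Real.sSup_of_not_bddAbove h,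
      Real.sSup_of_not_bddAbove fun h' => h (h'.mono (Set.subset_insert _ _))]
end

section
/- Let X be a real Banach space with dim X ≥ 2 and let p ∈ [0,1]. Then 1 ≤ MR_p(X) ≤ 2. -/
open Filter

theorem alphaP_comm {X : Type*} [NormedAddCommGroup X] [NormedSpace ℝ X] (p : ℝ) (x y : X) :
    alphaP p x y = alphaP p y x := norm_sub_rev _ _

theorem betaP_comm {X : Type*} [NormedAddCommGroup X] [NormedSpace ℝ X] (p : ℝ) (x y : X) :
    betaP p x y = betaP p y x := norm_sub_rev _ _

theorem norm_smul_sub_smul_le_two_mul {X : Type*} [NormedAddCommGroup X] [NormedSpace ℝ X]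
    {s t : ℝ} (hs : 0 < s) (hst : s ≤ t) {x y : X} (h : t * ‖y‖ ≤ s * ‖x‖) :
    ‖s • x - t • y‖ ≤ 2 * ‖t • x - s • y‖ := by
  have ht : 0 < t := hs.trans_le hst
  have hsq : 0 ≤ t ^ 2 - s ^ 2 := by nlinarith
  have hdecomp : t • (s • x - t • y) = s • (t • x - s • y) - (t ^ 2 - s ^ 2) • y := by
    module
  have hupper : t * ‖s • x - t • y‖ ≤ s * ‖t • x - s • y‖ + (t ^ 2 - s ^ 2) * ‖y‖ := by
    have := norm_sub_le (s • (t • x - s • y)) ((t ^ 2 - s ^ 2) • y)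
    rwa [← hdecomp, norm_smul_of_nonneg ht.le, norm_smul_of_nonneg hs.le,
      norm_smul_of_nonneg hsq] at this
  have hlower : t * ‖x‖ - s * ‖y‖ ≤ ‖t • x - s • y‖ := by
    have := norm_sub_norm_le (t • x) (s • y)
    rwa [norm_smul_of_nonneg ht.le, norm_smul_of_nonneg hs.le] at this
  have hs_lower := mul_le_mul_of_nonneg_left hlower hs.le
  have ht_h := mul_le_mul_of_nonneg_left h ht.le
  have hst_norm := mul_le_mul_of_nonneg_right hst (norm_nonneg (t • x - s • y))
  refine le_of_mul_le_mul_left ?_ ht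
  linarith

theorem alphaP_le_two_mul_betaP {X : Type*} [NormedAddCommGroup X] [NormedSpace ℝ X]
    {p : ℝ} (hp0 : 0 ≤ p) (hp1 : p ≤ 1) {x y : X} (hx : x ≠ 0) (hy : y ≠ 0) :
    alphaP p x y ≤ 2 * betaP p x y := by
  wlog hxy : ‖y‖ ≤ ‖x‖ generalizing x y
  · rw [alphaP_comm, betaP_comm]
    exact this hy hx (le_of_not_ge hxy)
  have hx' := norm_pos_iff.mpr hx
  have hy' := norm_pos_iff.mpr hy
  refine norm_smul_sub_smul_le_two_mul (Real.rpow_pos_of_pos hx' _)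
    (Real.rpow_le_rpow_of_nonpos hy' hxy (by linarith)) ?_
  rw [Real.rpow_sub_one hx'.ne', Real.rpow_sub_one hy'.ne', div_mul_cancel₀ _ hx'.ne',
    div_mul_cancel₀ _ hy'.ne']
  exact Real.rpow_le_rpow hy'.le hxy hp0

theorem stmt1 (X : Type*) [NormedAddCommGroup X] [NormedSpace ℝ X] [CompleteSpace X]
    (hdim : 2 ≤ Module.rank ℝ X) (p : ℝ) (hp0 : 0 ≤ p) (hp1 : p ≤ 1) :
    1 ≤ MRconst X p ∧ MRconst X p ≤ 2 := by
  have hbound : ∀ r ∈ { r : ℝ | ∃ x y : X, x ≠ 0 ∧ y ≠ 0 ∧ betaP p x y ≠ 0 ∧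
      r = alphaP p x y / betaP p x y }, r ≤ 2 := by
    rintro r ⟨x, y, hx, hy, -, rfl⟩
    exact div_le_of_le_mul₀ (norm_nonneg _) zero_le_two
      (alphaP_le_two_mul_betaP hp0 hp1 hx hy)
  have : Nontrivial X :=
    rank_pos_iff_nontrivial.mp (lt_of_lt_of_le two_pos hdim)
  obtain ⟨x, hx⟩ := exists_norm_eq X zero_le_one
  have hx0 : x ≠ 0 := norm_ne_zero_iff.mp (by rw [hx]; exact one_ne_zero)
  have hβ : betaP p x (-x) ≠ 0 := by
    simp [betaP, hx, ← two_smul ℝ x, hx0]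
  refine ⟨le_csSup ⟨2, hbound⟩ ⟨x, -x, hx0, neg_ne_zero.mpr hx0, hβ, ?_⟩,
    Real.sSup_le hbound zero_le_two⟩
  rw [eq_div_iff hβ, one_mul]
  simp [alphaP, betaP]
end

section
/- Let X be a real normed space and let p be a real number with 1 ≤ p < 2 (equivalently p/(2−p) ≥ 1). Then for all nonzero x, y ∈ X, α_p[x,y] ≤ (p/(2−p)) · max(‖x‖^{p−1}‖y‖^{1−p}, ‖y‖^{p−1}‖x‖^{1−p}) · β_p[x,y]. -/
open Filter

/-- The map `u ↦ ‖u‖ ^ (s - 1) • u` is Lipschitz with constant `s * R ^ (s - 1)` on the ball of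
radius `R`. -/
theorem norm_rpow_smul_sub_le {X : Type*} [NormedAddCommGroup X] [NormedSpace ℝ X]
    {s : ℝ} (hs : 1 ≤ s) {u v : X} (hu : u ≠ 0) (hv : v ≠ 0) (huv : ‖v‖ ≤ ‖u‖) :
    ‖(‖u‖ ^ (s - 1)) • u - (‖v‖ ^ (s - 1)) • v‖ ≤ s * ‖u‖ ^ (s - 1) * ‖u - v‖ := by
  have ha : 0 < ‖u‖ := norm_pos_iff.mpr hu
  have hb : 0 < ‖v‖ := norm_pos_iff.mpr hv
  have hsub : ‖u‖ - ‖v‖ ≤ ‖u - v‖ := norm_sub_norm_le u v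
  have hmono : ‖v‖ ^ (s - 1) ≤ ‖u‖ ^ (s - 1) :=
    Real.rpow_le_rpow hb.le huv (by linarith)
  have hpow : 0 < ‖u‖ ^ (s - 1) := Real.rpow_pos_of_pos ha _
  have hdecomp : (‖u‖ ^ (s - 1)) • u - (‖v‖ ^ (s - 1)) • v =
      (‖u‖ ^ (s - 1)) • (u - v) + (‖u‖ ^ (s - 1) - ‖v‖ ^ (s - 1)) • v := by
    module
  have hbern : 1 + s * (‖v‖ / ‖u‖ - 1) ≤ (‖v‖ / ‖u‖) ^ s := by
    have h := one_add_mul_self_le_rpow_one_add (s := ‖v‖ / ‖u‖ - 1)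
      (by linarith [div_pos hb ha]) hs
    rwa [add_sub_cancel] at h
  have hscaled : ‖u‖ ^ (s - 1) * (‖u‖ + s * (‖v‖ - ‖u‖)) ≤ ‖v‖ ^ (s - 1) * ‖v‖ := by
    have h := mul_le_mul_of_nonneg_left hbern (mul_pos hpow ha).le
    have hv' : ‖u‖ ^ (s - 1) * ‖u‖ * (‖v‖ / ‖u‖) ^ s = ‖v‖ ^ (s - 1) * ‖v‖ := by
      rw [Real.div_rpow hb.le ha.le, ← Real.rpow_add_one ha.ne', ← Real.rpow_add_one hb.ne',
        sub_add_cancel]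
      field_simp
    rw [hv'] at h
    refine le_of_eq_of_le ?_ h
    field_simp
  calc ‖(‖u‖ ^ (s - 1)) • u - (‖v‖ ^ (s - 1)) • v‖
      ≤ ‖u‖ ^ (s - 1) * ‖u - v‖ + (‖u‖ ^ (s - 1) - ‖v‖ ^ (s - 1)) * ‖v‖ := by
        rw [hdecomp]
        refine (norm_add_le _ _).trans_eq ?_
        rw [norm_smul, norm_smul, Real.norm_of_nonneg hpow.le,
          Real.norm_of_nonneg (sub_nonneg.mpr hmono)]
    _ ≤ s * ‖u‖ ^ (s - 1) * ‖u - v‖ := by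
        have h := mul_le_mul_of_nonneg_left hsub
          (mul_nonneg (sub_nonneg.mpr hs) hpow.le)
        linarith

theorem norm_rpow_smul_self {X : Type*} [NormedAddCommGroup X] [NormedSpace ℝ X]
    (p : ℝ) {x : X} (hx : x ≠ 0) : ‖(‖x‖ ^ (1 - p)) • x‖ = ‖x‖ ^ (2 - p) := by
  have ha : 0 < ‖x‖ := norm_pos_iff.mpr hx
  rw [norm_smul, Real.norm_of_nonneg (Real.rpow_nonneg ha.le _), ← Real.rpow_add_one ha.ne']
  ring_nf

theorem alphaP_le_of_norm_le {X : Type*} [NormedAddCommGroup X] [NormedSpace ℝ X]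
    {p : ℝ} (hp1 : 1 ≤ p) (hp2 : p < 2) {x y : X} (hx : x ≠ 0) (hy : y ≠ 0)
    (hxy : ‖y‖ ≤ ‖x‖) :
    alphaP p x y ≤ p / (2 - p) * (‖x‖ ^ (p - 1) * ‖y‖ ^ (1 - p)) * betaP p x y := by
  have hr : 0 < 2 - p := by linarith
  have hs : 1 ≤ p / (2 - p) := by rw [one_le_div hr]; linarith
  have hexp : (2 - p) * (p / (2 - p) - 1) = (p - 1) + (p - 1) := by field_simp; ring
  have hcancel : ∀ z : X, z ≠ 0 → ‖z‖ ^ (p - 1) * ‖z‖ ^ (1 - p) = 1 := fun z hz ↦ by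
    rw [← Real.rpow_add (norm_pos_iff.mpr hz)]
    simp
  have hpow : ∀ z : X, z ≠ 0 →
      ‖(‖z‖ ^ (1 - p)) • z‖ ^ (p / (2 - p) - 1) = ‖z‖ ^ (p - 1) * ‖z‖ ^ (p - 1) := fun z hz ↦ by
    rw [norm_rpow_smul_self p hz, ← Real.rpow_mul (norm_nonneg z), hexp,
      Real.rpow_add (norm_pos_iff.mpr hz)]
  have hsmul : ∀ z : X, z ≠ 0 → ‖z‖ ^ (1 - p) • z ≠ 0 := fun z hz ↦
    smul_ne_zero (Real.rpow_pos_of_pos (norm_pos_iff.mpr hz) _).ne' hz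
  have hmain := norm_rpow_smul_sub_le hs (hsmul x hx) (hsmul y hy) (by
    rw [norm_rpow_smul_self p hx, norm_rpow_smul_self p hy]
    exact Real.rpow_le_rpow (norm_nonneg y) hxy hr.le)
  rw [hpow x hx, hpow y hy, smul_smul, smul_smul, mul_assoc (‖x‖ ^ (p - 1)), hcancel x hx,
    mul_assoc (‖y‖ ^ (p - 1)), hcancel y hy, mul_one, mul_one] at hmain
  have hbeta : ‖x‖ ^ (p - 1) * ‖(‖x‖ ^ (1 - p)) • x - (‖y‖ ^ (1 - p)) • y‖ =
      ‖y‖ ^ (1 - p) * betaP p x y := by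
    rw [betaP, ← Real.norm_of_nonneg (Real.rpow_nonneg (norm_nonneg x) (p - 1)),
      ← Real.norm_of_nonneg (Real.rpow_nonneg (norm_nonneg y) (1 - p)), ← norm_smul,
      ← norm_smul, Real.norm_of_nonneg (Real.rpow_nonneg (norm_nonneg x) (p - 1)),
      Real.norm_of_nonneg (Real.rpow_nonneg (norm_nonneg y) (1 - p)), smul_sub, smul_sub,
      smul_smul, smul_smul, smul_smul, smul_smul, hcancel x hx,
      mul_comm (‖y‖ ^ (1 - p)) (‖y‖ ^ (p - 1)), hcancel y hy,
      mul_comm (‖y‖ ^ (1 - p)) (‖x‖ ^ (p - 1))]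
  refine hmain.trans_eq ?_
  linear_combination (p / (2 - p) * ‖x‖ ^ (p - 1)) * hbeta

theorem stmt3 (X : Type*) [NormedAddCommGroup X] [NormedSpace ℝ X]
    (p : ℝ) (hp1 : 1 ≤ p) (hp2 : p < 2)
    (x y : X) (hx : x ≠ 0) (hy : y ≠ 0) :
    alphaP p x y ≤ (p / (2 - p)) *
      (max (‖x‖ ^ (p - 1) * ‖y‖ ^ (1 - p)) (‖y‖ ^ (p - 1) * ‖x‖ ^ (1 - p))) *
      betaP p x y := by
  have hs : 0 ≤ p / (2 - p) := div_nonneg (by linarith) (by linarith)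
  have hβ : 0 ≤ betaP p x y := norm_nonneg _
  rcases le_total ‖y‖ ‖x‖ with hxy | hxy
  · refine (alphaP_le_of_norm_le hp1 hp2 hx hy hxy).trans ?_
    gcongr
    exact le_max_left _ _
  · rw [alphaP_comm]
    refine (alphaP_le_of_norm_le hp1 hp2 hy hx hxy).trans ?_
    rw [betaP_comm p y x]
    gcongr
    exact le_max_right _ _
end

section
/- Let X be a real normed space with dim X ≥ 2. Then the norm of X arises from an inner product if and only if MR_p(X) = 1 for every p ∈ [0,1). -/
open Filter

/-- A form of Lorch's condition: among the vectors `p² • u + q² • v` with `‖u‖ = ‖v‖` and `p q`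
fixed, the norm is smallest at `p = q`. -/
def LorchCondition (X : Type*) [NormedAddCommGroup X] [NormedSpace ℝ X] : Prop :=
  ∀ u v : X, ‖u‖ = ‖v‖ → ∀ p q : ℝ, 0 < p → 0 < q →
    p * q * ‖u + v‖ ≤ ‖p ^ 2 • u + q ^ 2 • v‖

/-- Birkhoff–James orthogonality. -/
def BirkhoffOrthogonal {X : Type*} [NormedAddCommGroup X] [NormedSpace ℝ X] (w z : X) : Prop :=
  ∀ t : ℝ, ‖w‖ ≤ ‖w + t • z‖

section Lorch

variable {X : Type*} [NormedAddCommGroup X] [NormedSpace ℝ X]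

theorem LorchCondition.birkhoffOrthogonal (hL : LorchCondition X) {u v : X} (huv : ‖u‖ = ‖v‖) :
    BirkhoffOrthogonal (u + v) (u - v) := by
  intro τ
  by_contra! hlt
  set w := u + v
  set z := u - v
  set D := ‖w‖ - ‖w + τ • z‖ with hD
  have hDpos : 0 < D := by linarith
  have key : ∀ ε : ℝ, 0 < ε → ε ≤ 1 → ε * |τ| < 2 → D ≤ ε * (τ ^ 2 * ‖w‖ / 2) := by
    intro ε h0 h1 h2
    set δ := ε * τ / 2 with hδ
    have habs : |δ| < 1 := by
      rw [hδ, abs_div, abs_mul, abs_of_pos h0, abs_two]; linarith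
    obtain ⟨hl, hr⟩ := abs_lt.1 habs
    have h := hL u v huv (1 + δ) (1 - δ) (by linarith) (by linarith)
    have e1 : (1 + δ) ^ 2 • u + (1 - δ) ^ 2 • v = δ ^ 2 • w + (w + (ε * τ) • z) := by
      simp only [w, z, hδ]; module
    have e2 : w + (ε * τ) • z = (1 - ε) • w + ε • (w + τ • z) := by module
    have n1 : ‖δ ^ 2 • w + (w + (ε * τ) • z)‖ ≤ δ ^ 2 * ‖w‖ + ‖w + (ε * τ) • z‖ := by
      refine (norm_add_le _ _).trans ?_
      rw [norm_smul, Real.norm_of_nonneg (sq_nonneg δ)]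
    have n2 : ‖w + (ε * τ) • z‖ ≤ (1 - ε) * ‖w‖ + ε * ‖w + τ • z‖ := by
      rw [e2]
      refine (norm_add_le _ _).trans ?_
      rw [norm_smul, norm_smul, Real.norm_of_nonneg (by linarith : 0 ≤ 1 - ε),
        Real.norm_of_nonneg h0.le]
    rw [e1] at h
    have h3 : ε * D ≤ ε * (ε * (τ ^ 2 * ‖w‖ / 2)) := by
      have e3 : ε * (ε * (τ ^ 2 * ‖w‖ / 2)) = 2 * δ ^ 2 * ‖w‖ := by rw [hδ]; ring
      have e4 : (1 + δ) * (1 - δ) * ‖u + v‖ = ‖w‖ - δ ^ 2 * ‖w‖ := by simp only [w]; ring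
      rw [e3, hD]
      linarith
    exact le_of_mul_le_mul_left h3 h0
  set K := τ ^ 2 * ‖w‖ / 2 with hK
  have hK0 : 0 ≤ K := by positivity
  have hτ : 0 ≤ |τ| := abs_nonneg τ
  have hden : 0 < (1 + |τ|) * (1 + K + D) := by positivity
  have h1 : D / ((1 + |τ|) * (1 + K + D)) ≤ 1 := by
    rw [div_le_one hden]
    nlinarith [mul_nonneg hτ hK0, mul_nonneg hτ hDpos.le]
  have h2 : D / ((1 + |τ|) * (1 + K + D)) * |τ| < 2 := by
    rw [div_mul_eq_mul_div, div_lt_iff₀ hden]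
    nlinarith [mul_nonneg hτ hK0, mul_nonneg hτ hDpos.le]
  have h3 := key _ (by positivity) h1 h2
  rw [div_mul_eq_mul_div, le_div_iff₀ hden] at h3
  have h4 := le_of_mul_le_mul_left h3 hDpos
  nlinarith [mul_nonneg hτ hK0, mul_nonneg hτ hDpos.le]

theorem LorchCondition.norm_add_eq_norm_sub (hL : LorchCondition X) {w z : X}
    (h : BirkhoffOrthogonal w z) : ‖w + z‖ = ‖w - z‖ := by
  rcases eq_or_ne w 0 with rfl | hw
  · simp
  have hm : 0 < ‖w‖ := norm_pos_iff.2 hw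
  have hc : 0 < ‖w + z‖ := hm.trans_le (by simpa using h 1)
  have hC : 0 < ‖w - z‖ := hm.trans_le (by simpa [sub_eq_add_neg] using h (-1))
  set p := √‖w + z‖ with hp
  set q := √‖w - z‖ with hq
  have hp0 : 0 < p := Real.sqrt_pos.2 hc
  have hq0 : 0 < q := Real.sqrt_pos.2 hC
  have hp2 : p ^ 2 = ‖w + z‖ := Real.sq_sqrt hc.le
  have hq2 : q ^ 2 = ‖w - z‖ := Real.sq_sqrt hC.le
  have hle := hL (q ^ 2 • (w + z)) (p ^ 2 • (w - z))
    (by rw [norm_smul, norm_smul, Real.norm_of_nonneg (sq_nonneg q),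
          Real.norm_of_nonneg (sq_nonneg p), ← hp2, ← hq2, mul_comm]) p q hp0 hq0
  have hs : 0 < p ^ 2 + q ^ 2 := by positivity
  have e1 : q ^ 2 • (w + z) + p ^ 2 • (w - z) =
      (p ^ 2 + q ^ 2) • (w + ((q ^ 2 - p ^ 2) / (p ^ 2 + q ^ 2)) • z) := by
    rw [smul_add (p ^ 2 + q ^ 2), smul_smul, mul_div_cancel₀ _ hs.ne']; module
  have e2 : p ^ 2 • q ^ 2 • (w + z) + q ^ 2 • p ^ 2 • (w - z) = (2 * p ^ 2 * q ^ 2) • w := by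
    module
  rw [e1, e2, norm_smul, norm_smul, Real.norm_of_nonneg hs.le,
    Real.norm_of_nonneg (by positivity)] at hle
  have h1 : p * q * ((p ^ 2 + q ^ 2) * ‖w‖) ≤ 2 * p ^ 2 * q ^ 2 * ‖w‖ :=
    le_trans (by gcongr; exact h _) hle
  have h2 : (p * q * ‖w‖) * (p ^ 2 + q ^ 2) ≤ (p * q * ‖w‖) * (2 * p * q) := by linarith
  have h3 := le_of_mul_le_mul_left h2 (by positivity)
  have h4 : p = q := by nlinarith [sq_nonneg (p - q)]
  rw [← hp2, ← hq2, h4]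

theorem BirkhoffOrthogonal.smul_right {w z : X} (h : BirkhoffOrthogonal w z) (a : ℝ) :
    BirkhoffOrthogonal w (a • z) := fun t => by
  rw [smul_smul]; exact h _

theorem LorchCondition.norm_smul_add_eq (hL : LorchCondition X) {w z : X}
    (h : BirkhoffOrthogonal w z) (a b : ℝ) : ‖a • w + b • z‖ = ‖a • w - b • z‖ := by
  rcases eq_or_ne a 0 with rfl | ha
  · simp
  have := hL.norm_add_eq_norm_sub (h.smul_right (b / a))
  have e1 : a • w + b • z = a • (w + (b / a) • z) := by
    rw [smul_add, smul_smul, mul_div_cancel₀ _ ha]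
  have e2 : a • w - b • z = a • (w - (b / a) • z) := by
    rw [smul_sub, smul_smul, mul_div_cancel₀ _ ha]
  rw [e1, e2, norm_smul, norm_smul, this]

theorem LorchCondition.eq_zero_of_norm_add_eq (hL : LorchCondition X) {w z : X}
    (h : BirkhoffOrthogonal w z) (hz : ‖w + z‖ = ‖w‖) : z = 0 := by
  have key : ∀ n : ℕ, ‖w + (n : ℝ) • z‖ = ‖w‖ ∧ ‖w + ((n : ℝ) + 1) • z‖ = ‖w‖ := by
    intro n
    induction n with
    | zero => simpa using hz
    | succ n ih =>
      push_cast
      refine ⟨ih.2, ?_⟩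
      have hb : BirkhoffOrthogonal (w + ((n : ℝ) + 1) • z) z := fun t => by
        rw [ih.2, add_assoc, ← add_smul]; exact h _
      have := hL.norm_add_eq_norm_sub hb
      have e1 : w + ((n : ℝ) + 1) • z + z = w + ((n : ℝ) + 1 + 1) • z := by module
      have e2 : w + ((n : ℝ) + 1) • z - z = w + (n : ℝ) • z := by module
      rw [← e1, this, e2, ih.1]
  by_contra hne
  have hpos : 0 < ‖z‖ := norm_pos_iff.2 hne
  obtain ⟨n, hn⟩ := exists_nat_gt (2 * ‖w‖ / ‖z‖)
  rw [div_lt_iff₀ hpos] at hn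
  have h1 : ‖(n : ℝ) • z‖ ≤ ‖w + (n : ℝ) • z‖ + ‖w‖ := by
    simpa using norm_sub_le (w + (n : ℝ) • z) w
  rw [(key n).1, norm_smul, Real.norm_of_nonneg (Nat.cast_nonneg n)] at h1
  linarith

theorem LorchCondition.norm_smul_add_swap (hL : LorchCondition X) {u v : X} (huv : ‖u‖ = ‖v‖)
    (a b : ℝ) : ‖a • u + b • v‖ = ‖b • u + a • v‖ := by
  have := hL.norm_smul_add_eq (hL.birkhoffOrthogonal huv) ((a + b) / 2) ((a - b) / 2)
  have e1 : ((a + b) / 2) • (u + v) + ((a - b) / 2) • (u - v) = a • u + b • v := by module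
  have e2 : ((a + b) / 2) • (u + v) - ((a - b) / 2) • (u - v) = b • u + a • v := by module
  rwa [e1, e2] at this

theorem LorchCondition.birkhoffOrthogonal_symm (hL : LorchCondition X) {w z : X}
    (h : BirkhoffOrthogonal w z) : BirkhoffOrthogonal z w := fun t => by
  have h1 := hL.norm_smul_add_eq h t 1
  have e : (2 : ℝ) • z = (t • w + (1 : ℝ) • z) - (t • w - (1 : ℝ) • z) := by module
  have h2 := norm_sub_le (t • w + (1 : ℝ) • z) (t • w - (1 : ℝ) • z)
  rw [← e, ← h1, norm_smul, Real.norm_two, one_smul, add_comm] at h2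
  rw [add_comm z]
  linarith [add_comm z (t • w)]

/-- If `e` and `f` are orthogonal, the norm of `a • e + s • f` is strictly increasing in `s ≥ 0`. -/
theorem LorchCondition.norm_smul_add_lt (hL : LorchCondition X) {e f : X}
    (h : BirkhoffOrthogonal e f) (hf : f ≠ 0) {a s t : ℝ} (hs : 0 ≤ s) (hst : s < t) :
    ‖a • e + s • f‖ < ‖a • e + t • f‖ := by
  have h0 : BirkhoffOrthogonal (a • e) f := fun r => by
    rcases eq_or_ne a 0 with rfl | ha
    · simp
    have e1 : a • e + r • f = a • (e + (r / a) • f) := by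
      rw [smul_add, smul_smul, mul_div_cancel₀ _ ha]
    rw [e1, norm_smul, norm_smul]
    gcongr
    exact h _
  have ht : 0 < t := hs.trans_lt hst
  have hlt : ‖a • e‖ < ‖a • e + t • f‖ := by
    refine lt_of_le_of_ne (h0 t) fun heq => ?_
    have := hL.eq_zero_of_norm_add_eq (h0.smul_right t) heq.symm
    exact (smul_ne_zero ht.ne' hf) this
  have e1 : a • e + s • f = (1 - s / t) • (a • e) + (s / t) • (a • e + t • f) := by
    have : (s / t) • t • f = s • f := by rw [smul_smul, div_mul_cancel₀ _ ht.ne']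
    rw [smul_add, this]; module
  have hst1 : s / t < 1 := (div_lt_one ht).2 hst
  have hst0 : 0 ≤ s / t := by positivity
  calc ‖a • e + s • f‖ ≤ (1 - s / t) * ‖a • e‖ + (s / t) * ‖a • e + t • f‖ := by
        rw [e1]
        refine (norm_add_le _ _).trans ?_
        rw [norm_smul (1 - s / t), norm_smul (s / t), Real.norm_of_nonneg hst0,
          Real.norm_of_nonneg (by linarith : 0 ≤ 1 - s / t)]
    _ < ‖a • e + t • f‖ := by nlinarith

theorem LorchCondition.sq_add_sq_eq_one (hL : LorchCondition X) {e f : X}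
    (h : BirkhoffOrthogonal e f) (he : ‖e‖ = 1) (hf : ‖f‖ = 1) {a b : ℝ}
    (hab : ‖a • e + b • f‖ = 1) : a ^ 2 + b ^ 2 = 1 := by
  have hf0 : f ≠ 0 := fun h => by simp [h] at hf
  wlog hb : 0 ≤ b generalizing b
  · have := this (b := -b) (by rw [neg_smul, ← sub_eq_add_neg, ← hL.norm_smul_add_eq h, hab])
      (by linarith)
    simpa using this
  have ha : |a| ≤ 1 := by
    by_contra! hlt
    have hz := h (b / a)
    have ha0 : a ≠ 0 := by rintro rfl; simp at hlt; linarith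
    have e1 : a • e + b • f = a • (e + (b / a) • f) := by
      rw [smul_add, smul_smul, mul_div_cancel₀ _ ha0]
    rw [e1, norm_smul, Real.norm_eq_abs] at hab
    rw [he] at hz
    nlinarith
  have ha2 : a ^ 2 ≤ 1 := (sq_le_one_iff_abs_le_one a).2 ha
  rcases hb.eq_or_lt with rfl | hb
  · simp only [zero_smul, add_zero, norm_smul, he, mul_one, Real.norm_eq_abs] at hab
    rw [← sq_abs, hab]; norm_num
  have h1 := hL.norm_smul_add_swap (he.trans hab.symm) (-a) 1
  have e1 : (-a) • e + (1 : ℝ) • (a • e + b • f) = b • f := by module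
  have e2 : (1 : ℝ) • e + (-a) • (a • e + b • f) = b • (((1 - a ^ 2) / b) • e - a • f) := by
    rw [smul_sub, smul_smul, mul_div_cancel₀ _ hb.ne']; module
  rw [e1, e2, norm_smul, norm_smul, hf] at h1
  have h2 : ‖a • e + ((1 - a ^ 2) / b) • f‖ = 1 := by
    rw [hL.norm_smul_add_swap (he.trans hf.symm), hL.norm_smul_add_eq h]
    exact (mul_left_cancel₀ (norm_ne_zero_iff.2 hb.ne') h1).symm
  have h3 : (1 - a ^ 2) / b = b := by
    have hs : 0 ≤ (1 - a ^ 2) / b := div_nonneg (by linarith) hb.le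
    rcases lt_trichotomy ((1 - a ^ 2) / b) b with hlt | heq | hlt
    · have := hL.norm_smul_add_lt (a := a) h hf0 hs hlt
      linarith
    · exact heq
    · have := hL.norm_smul_add_lt (a := a) h hf0 hb.le hlt
      linarith
  rw [div_eq_iff hb.ne'] at h3
  linarith

/-- The Pythagorean theorem for Birkhoff–James orthogonal vectors. -/
theorem LorchCondition.norm_smul_add_sq (hL : LorchCondition X) {w z : X}
    (h : BirkhoffOrthogonal w z) (a b : ℝ) :
    ‖a • w + b • z‖ ^ 2 = a ^ 2 * ‖w‖ ^ 2 + b ^ 2 * ‖z‖ ^ 2 := by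
  rcases eq_or_ne w 0 with rfl | hw
  · simp [norm_smul, mul_pow]
  rcases eq_or_ne z 0 with rfl | hz
  · simp [norm_smul, mul_pow]
  have hw' := norm_ne_zero_iff.2 hw
  have hz' := norm_ne_zero_iff.2 hz
  rcases eq_or_ne (‖a • w + b • z‖) 0 with h0 | h0
  · have hz0 := h (b / a)
    rcases eq_or_ne a 0 with rfl | ha
    · simp only [zero_smul, zero_add] at h0 ⊢
      rw [norm_smul, mul_pow, Real.norm_eq_abs, sq_abs]; ring
    · have e1 : a • w + b • z = a • (w + (b / a) • z) := by
        rw [smul_add, smul_smul, mul_div_cancel₀ _ ha]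
      rw [e1, norm_smul] at h0
      rcases mul_eq_zero.1 h0 with h1 | h1
      · exact absurd (norm_eq_zero.1 h1) ha
      · exact absurd (le_antisymm (hz0.trans h1.le) (norm_nonneg _)) hw'
  set N := ‖a • w + b • z‖ with hN
  have horth : BirkhoffOrthogonal (‖w‖⁻¹ • w) (‖z‖⁻¹ • z) := fun t => by
    have e1 : ‖w‖⁻¹ • w + t • ‖z‖⁻¹ • z = ‖w‖⁻¹ • (w + (‖w‖ * t * ‖z‖⁻¹) • z) := by
      rw [smul_add, smul_smul, smul_smul, mul_assoc, inv_mul_cancel_left₀ hw']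
    rw [e1, norm_smul, norm_smul]
    gcongr
    exact h _
  have key := hL.sq_add_sq_eq_one horth (norm_smul_inv_norm hw) (norm_smul_inv_norm hz)
    (a := N⁻¹ * (a * ‖w‖)) (b := N⁻¹ * (b * ‖z‖)) (by
      have e1 : (N⁻¹ * (a * ‖w‖)) • ‖w‖⁻¹ • w + (N⁻¹ * (b * ‖z‖)) • ‖z‖⁻¹ • z =
          N⁻¹ • (a • w + b • z) := by
        rw [smul_smul, smul_smul, mul_assoc N⁻¹, mul_assoc N⁻¹, mul_inv_cancel_right₀ hw',
          mul_inv_cancel_right₀ hz']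
        module
      rw [e1, norm_smul, ← hN, norm_inv, Real.norm_of_nonneg (norm_nonneg _),
        inv_mul_cancel₀ h0])
  field_simp at key
  linarith

theorem exists_birkhoffOrthogonal_add_smul (x y : X) :
    ∃ t : ℝ, BirkhoffOrthogonal (y + t • x) x := by
  rcases eq_or_ne x 0 with rfl | hx
  · exact ⟨0, fun t => by simp⟩
  have hx' : 0 < ‖x‖ := norm_pos_iff.2 hx
  have hlim : Tendsto (fun t : ℝ => ‖y + t • x‖) (cocompact ℝ) atTop := by
    have h1 : Tendsto (fun t : ℝ => ‖t‖ * ‖x‖ - ‖y‖) (cocompact ℝ) atTop :=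
      tendsto_atTop_add_const_right _ _ (tendsto_norm_cocompact_atTop.atTop_mul_const hx')
    refine tendsto_atTop_mono (fun t => ?_) h1
    have := norm_sub_le (y + t • x) y
    rw [add_sub_cancel_left, norm_smul] at this
    linarith
  obtain ⟨t, ht⟩ := (by fun_prop : Continuous fun t : ℝ => ‖y + t • x‖).exists_forall_le hlim
  exact ⟨t, fun s => by rw [add_assoc, ← add_smul]; exact ht _⟩

theorem LorchCondition.parallelogram (hL : LorchCondition X) (x y : X) :
    ‖x + y‖ * ‖x + y‖ + ‖x - y‖ * ‖x - y‖ = 2 * (‖x‖ * ‖x‖ + ‖y‖ * ‖y‖) := by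
  obtain ⟨t, ht⟩ := exists_birkhoffOrthogonal_add_smul x y
  set w := y + t • x with hw
  have hy : y = (1 : ℝ) • w + (-t) • x := by rw [hw]; module
  have h1 : x + y = (1 : ℝ) • w + (1 - t) • x := by rw [hw]; module
  have h2 : x - y = (-1 : ℝ) • w + (1 + t) • x := by rw [hw]; module
  have n := congrArg (fun v => ‖v‖ ^ 2) hy
  have n1 := congrArg (fun v => ‖v‖ ^ 2) h1
  have n2 := congrArg (fun v => ‖v‖ ^ 2) h2
  simp only [hL.norm_smul_add_sq ht] at n n1 n2
  linarith

end Lorch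

section MaligrandaRooin

variable {X : Type*} [NormedAddCommGroup X] [NormedSpace ℝ X]

theorem alphaP_le_betaP_of_MRconst_eq_one {p : ℝ} (h : MRconst X p = 1) {x y : X} (hx : x ≠ 0)
    (hy : y ≠ 0) (hβ : betaP p x y ≠ 0) : alphaP p x y ≤ betaP p x y := by
  have hbdd : BddAbove { r : ℝ | ∃ x y : X, x ≠ 0 ∧ y ≠ 0 ∧ betaP p x y ≠ 0 ∧
      r = alphaP p x y / betaP p x y } := by
    by_contra hn
    rw [MRconst, Real.sSup_of_not_bddAbove hn] at h
    exact zero_ne_one h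
  have h1 : alphaP p x y / betaP p x y ≤ 1 :=
    (le_csSup hbdd ⟨x, y, hx, hy, hβ, rfl⟩).trans h.le
  have hpos : 0 < betaP p x y := lt_of_le_of_ne (norm_nonneg _) hβ.symm
  exact (div_le_one hpos).1 h1

theorem lorchCondition_of_MRconst_zero_eq_one (h : MRconst X 0 = 1) : LorchCondition X := by
  intro u v huv p q hp hq
  rcases eq_or_ne u 0 with rfl | hu
  · have : v = 0 := norm_eq_zero.1 (by rw [← huv, norm_zero])
    simp [this]
  have hc : 0 < ‖u‖ := norm_pos_iff.2 hu
  have hv : v ≠ 0 := norm_pos_iff.1 (huv ▸ hc)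
  have hx : p • u ≠ 0 := smul_ne_zero hp.ne' hu
  have hy : -(q • v) ≠ 0 := neg_ne_zero.2 (smul_ne_zero hq.ne' hv)
  have hnx : ‖p • u‖ = p * ‖u‖ := by rw [norm_smul, Real.norm_of_nonneg hp.le]
  have hny : ‖-(q • v)‖ = q * ‖u‖ := by rw [norm_neg, norm_smul, Real.norm_of_nonneg hq.le, huv]
  have hα : alphaP 0 (p • u) (-(q • v)) = ‖u‖⁻¹ * ‖u + v‖ := by
    have e : (p * ‖u‖)⁻¹ • p • u - (q * ‖u‖)⁻¹ • (-(q • v)) = ‖u‖⁻¹ • (u + v) := by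
      rw [smul_neg, sub_neg_eq_add, smul_smul, smul_smul, smul_add]
      congr 2 <;> field_simp
    rw [alphaP, hnx, hny, zero_sub, Real.rpow_neg_one, Real.rpow_neg_one, e, norm_smul, norm_inv,
      norm_norm]
  have hβ : betaP 0 (p • u) (-(q • v)) = (p * q * ‖u‖)⁻¹ * ‖p ^ 2 • u + q ^ 2 • v‖ := by
    have e : (q * ‖u‖)⁻¹ • p • u - (p * ‖u‖)⁻¹ • (-(q • v)) =
        (p * q * ‖u‖)⁻¹ • (p ^ 2 • u + q ^ 2 • v) := by
      rw [smul_neg, sub_neg_eq_add, smul_smul, smul_smul, smul_add, smul_smul, smul_smul]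
      congr 2 <;> field_simp
    rw [betaP, hnx, hny, zero_sub, Real.rpow_neg_one, Real.rpow_neg_one, e, norm_smul,
      Real.norm_of_nonneg (by positivity)]
  rcases eq_or_ne (betaP 0 (p • u) (-(q • v))) 0 with h0 | h0
  · rw [hβ] at h0
    have h1 : ‖p ^ 2 • u + q ^ 2 • v‖ = 0 :=
      (mul_eq_zero.1 h0).resolve_left (by positivity)
    have h2 := eq_neg_of_add_eq_zero_left (norm_eq_zero.1 h1)
    have h3 := congrArg norm h2
    rw [norm_neg, norm_smul, norm_smul, Real.norm_of_nonneg (sq_nonneg p),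
      Real.norm_of_nonneg (sq_nonneg q), ← huv] at h3
    have h4 : p ^ 2 = q ^ 2 := mul_right_cancel₀ hc.ne' h3
    have h5 : p = q := (sq_eq_sq₀ hp.le hq.le).1 h4
    rw [h5, ← smul_add, norm_smul, Real.norm_of_nonneg (sq_nonneg q), sq]
  · have := alphaP_le_betaP_of_MRconst_eq_one h hx hy h0
    rw [hα, hβ, mul_inv, mul_comm _ ‖u‖⁻¹, mul_assoc] at this
    have h1 := le_of_mul_le_mul_left this (inv_pos.2 hc)
    rwa [← div_eq_inv_mul, le_div_iff₀ (by positivity), mul_comm] at h1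

theorem alphaP_neg_right_self (p : ℝ) (x : X) : alphaP p x (-x) = betaP p x (-x) := by
  simp [alphaP, betaP]

theorem betaP_neg_right_self_ne_zero (p : ℝ) {x : X} (hx : x ≠ 0) : betaP p x (-x) ≠ 0 := by
  have h : 0 < ‖x‖ ^ (p - 1) := Real.rpow_pos_of_pos (norm_pos_iff.2 hx) _
  rw [betaP, norm_neg, smul_neg, sub_neg_eq_add, ← add_smul]
  exact norm_ne_zero_iff.2 (smul_ne_zero (by positivity) hx)

theorem alphaP_le_betaP {E : Type*} [NormedAddCommGroup E] [InnerProductSpace ℝ E] {p : ℝ}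
    (hp : p ≤ 1) {x y : E} (hx : x ≠ 0) (hy : y ≠ 0) : alphaP p x y ≤ betaP p x y := by
  have hx' : 0 < ‖x‖ := norm_pos_iff.2 hx
  have hy' : 0 < ‖y‖ := norm_pos_iff.2 hy
  have hA : 0 < ‖x‖ ^ (p - 1) := Real.rpow_pos_of_pos hx' _
  have hB : 0 < ‖y‖ ^ (p - 1) := Real.rpow_pos_of_pos hy' _
  refine le_of_sq_le_sq ?_ (norm_nonneg _)
  rw [alphaP, betaP, norm_sub_sq_real, norm_sub_sq_real]
  simp only [norm_smul, real_inner_smul_left, real_inner_smul_right,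
    Real.norm_of_nonneg hA.le, Real.norm_of_nonneg hB.le]
  have key : (‖x‖ ^ 2 - ‖y‖ ^ 2) * ((‖x‖ ^ (p - 1)) ^ 2 - (‖y‖ ^ (p - 1)) ^ 2) ≤ 0 := by
    rcases le_total ‖x‖ ‖y‖ with hle | hle
    · have := Real.rpow_le_rpow_of_nonpos hx' hle (by linarith : p - 1 ≤ 0)
      exact mul_nonpos_of_nonpos_of_nonneg (sub_nonpos.2 (by gcongr)) (sub_nonneg.2 (by gcongr))
    · have := Real.rpow_le_rpow_of_nonpos hy' hle (by linarith : p - 1 ≤ 0)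
      exact mul_nonpos_of_nonneg_of_nonpos (sub_nonneg.2 (by gcongr)) (sub_nonpos.2 (by gcongr))
  linarith

/-- A normed group carries at most one structure of a real normed space. -/
theorem NormedSpace.real_eq {E : Type*} [NormedAddCommGroup E] (i j : NormedSpace ℝ E) :
    i = j := by
  have hi := @IsBoundedSMul.continuousSMul ℝ E _ _ _ _ (_)
    (@NormedSpace.toIsBoundedSMul ℝ E _ _ i)
  have hj := @IsBoundedSMul.continuousSMul ℝ E _ _ _ _ (_)
    (@NormedSpace.toIsBoundedSMul ℝ E _ _ j)
  have h : i.toModule = j.toModule := Module.ext' _ _ fun r x =>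
    @map_real_smul E _ i.toModule _ hi E _ j.toModule _ hj _ (E →+ E) _ _
      (AddMonoidHom.id E) continuous_id r x
  cases i
  cases j
  congr

end MaligrandaRooin

theorem stmt9 (X : Type*) [NormedAddCommGroup X] [NormedSpace ℝ X]
    (hdim : 2 ≤ Module.rank ℝ X) :
    Nonempty (InnerProductSpace ℝ X) ↔
      ∀ p : ℝ, 0 ≤ p → p < 1 → MRconst X p = 1 := by
  constructor
  · rintro ⟨inst⟩ p - hp
    obtain rfl := NormedSpace.real_eq ‹NormedSpace ℝ X› inst.toNormedSpace
    have : Nontrivial X := rank_pos_iff_nontrivial.1 (two_pos.trans_le hdim)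
    obtain ⟨x, hx⟩ := exists_ne (0 : X)
    have hβ := betaP_neg_right_self_ne_zero p hx
    refine IsGreatest.csSup_eq
      ⟨⟨x, -x, hx, neg_ne_zero.2 hx, hβ, by rw [alphaP_neg_right_self, div_self hβ]⟩, ?_⟩
    rintro r ⟨x, y, hx, hy, -, rfl⟩
    exact div_le_one_of_le₀ (alphaP_le_betaP hp.le hx hy) (norm_nonneg _)
  · intro h
    exact ⟨InnerProductSpace.ofNorm ℝ
      (lorchCondition_of_MRconst_zero_eq_one (h 0 le_rfl one_pos)).parallelogram⟩
end

section
/- Let X be a real inner product space and let p ≤ 1 be a real number. Then for all nonzero x, y ∈ X, α_p[x,y] ≤ β_p[x,y]. -/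
open Filter

/-- In a real inner product space, exchanging the coefficients of a difference `s • x - t • y`
does not decrease its norm when the coefficients are ordered oppositely to the norms. -/
theorem norm_smul_sub_smul_le_swap {X : Type*} [NormedAddCommGroup X] [InnerProductSpace ℝ X]
    (x y : X) {s t : ℝ} (h : 0 ≤ (t ^ 2 - s ^ 2) * (‖x‖ ^ 2 - ‖y‖ ^ 2)) :
    ‖s • x - t • y‖ ≤ ‖t • x - s • y‖ := by
  refine (sq_le_sq₀ (norm_nonneg _) (norm_nonneg _)).1 ?_
  simp only [norm_sub_sq_real, norm_smul, inner_smul_left, inner_smul_right, mul_pow,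
    Real.norm_eq_abs, sq_abs, conj_trivial]
  linarith

theorem stmt10 (X : Type*) [NormedAddCommGroup X] [InnerProductSpace ℝ X]
    (p : ℝ) (hp : p ≤ 1)
    (x y : X) (hx : x ≠ 0) (hy : y ≠ 0) :
    alphaP p x y ≤ betaP p x y := by
  have hx' := norm_pos_iff.2 hx
  have hy' := norm_pos_iff.2 hy
  have hp' : p - 1 ≤ 0 := sub_nonpos.2 hp
  refine norm_smul_sub_smul_le_swap x y ?_
  rcases le_total ‖x‖ ‖y‖ with h | h
  · have h' := Real.rpow_le_rpow_of_nonpos hx' h hp'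
    exact mul_nonneg_of_nonpos_of_nonpos (sub_nonpos.2 (by gcongr)) (sub_nonpos.2 (by gcongr))
  · have h' := Real.rpow_le_rpow_of_nonpos hy' h hp'
    exact mul_nonneg (sub_nonneg.2 (by gcongr)) (sub_nonneg.2 (by gcongr))
end
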